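/- arXiv:2301.08338 — 2 statements merged into one kernel-verified Lean document; each statement's English description precedes it below -/
import Mathlib

section
/- Assume Ψ satisfies the SOSC with feasible open set O, let μ_p be a self-similar measure, and assume μ_p(∂O) = 0 and that μ_p gives zero measure to every sphere in ℝⁿ (both known properties of self-similar measures under the SOSC). Let x ∈ E and d > 0 with B(x, d) ⊆ O, and let y ∈ E be a point whose shift orbit is dense in E. Then there exists a sequence (i_j) of finite words over M with r_{i_j} → 0 such that the measures p_{i_j}⁻¹ · (f_{i_j}⁻¹)_♯ (μ_p⌊_{B(y, d·r_{i_j})}) converge setwise to μ_p⌊_{B(x, d)}; explicitly, for every Borel set A ⊆ ℝⁿ, p_{i_j}⁻¹ · μ_p(B(y, d·r_{i_j}) ∩ f_{i_j}(A)) → μ_p(B(x, d) ∩ A) as j → ∞. -/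
open MeasureTheory Filter Topology
open scoped ENNReal

noncomputable section

/-- `f` is a similarity of ratio `r`. -/
def IsSimilarityRatio {X : Type*} [MetricSpace X] (f : X → X) (r : ℝ) : Prop :=
  ∀ x y, dist (f x) (f y) = r * dist x y

/-- The composition `f_{i₁} ∘ ⋯ ∘ f_{i_k}` associated with a finite word. -/
def wordMap {X : Type*} {m : ℕ} (f : Fin m → X → X) : List (Fin m) → X → X
  | [] => id
  | j :: l => f j ∘ wordMap f l

/-- The product `p_{i₁} ⋯ p_{i_k}` associated with a finite word. -/
def wordProd {m : ℕ} (p : Fin m → ℝ) (l : List (Fin m)) : ℝ := (l.map p).prod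

theorem IsSimilarityRatio.comp {X : Type*} [MetricSpace X] {f g : X → X} {a b : ℝ}
    (hf : IsSimilarityRatio f a) (hg : IsSimilarityRatio g b) :
    IsSimilarityRatio (f ∘ g) (a * b) := fun x y => by
  rw [Function.comp_apply, Function.comp_apply, hf, hg, mul_assoc]

theorem IsSimilarityRatio.injective {X : Type*} [MetricSpace X] {f : X → X} {a : ℝ}
    (hf : IsSimilarityRatio f a) (ha : 0 < a) : Function.Injective f := fun x y h => by
  have h1 := hf x y
  rw [h, dist_self] at h1
  exact dist_eq_zero.1 ((mul_eq_zero.1 h1.symm).resolve_left ha.ne')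

theorem IsSimilarityRatio.image_closedBall_inter {X : Type*} [MetricSpace X] {f : X → X} {a : ℝ}
    (hf : IsSimilarityRatio f a) (ha : 0 < a) (w : X) (d : ℝ) (A : Set X) :
    Metric.closedBall (f w) (d * a) ∩ f '' A = f '' (Metric.closedBall w d ∩ A) := by
  ext z
  constructor
  · rintro ⟨hz, u, hu, rfl⟩
    refine ⟨u, ⟨?_, hu⟩, rfl⟩
    rw [Metric.mem_closedBall, hf, mul_comm d] at hz
    exact le_of_mul_le_mul_left hz ha
  · rintro ⟨u, ⟨hz, hu⟩, rfl⟩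
    refine ⟨?_, u, hu, rfl⟩
    rw [Metric.mem_closedBall, hf, mul_comm d]
    exact mul_le_mul_of_nonneg_left hz ha.le

theorem IsSimilarityRatio.measurableEmbedding {X : Type*} [MetricSpace X] [CompleteSpace X]
    [MeasurableSpace X] [BorelSpace X] {f : X → X} {a : ℝ}
    (hf : IsSimilarityRatio f a) (ha : 0 < a) : MeasurableEmbedding f := by
  lift a to NNReal using ha.le
  have hlip : LipschitzWith a f := LipschitzWith.of_dist_le_mul fun x y => (hf x y).le
  have hanti : AntilipschitzWith a⁻¹ f := AntilipschitzWith.of_le_mul_dist fun x y => by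
    rw [hf, NNReal.coe_inv, inv_mul_cancel_left₀ ha.ne']
  exact (hanti.isClosedEmbedding hlip.uniformContinuous).measurableEmbedding

theorem wordProd_pos {m : ℕ} {p : Fin m → ℝ} (hp : ∀ i, 0 < p i) (l : List (Fin m)) :
    0 < wordProd p l :=
  List.prod_pos fun a ha => by
    obtain ⟨i, -, rfl⟩ := List.mem_map.1 ha
    exact hp i

theorem wordProd_le_pow {m : ℕ} {p : Fin m → ℝ} (hp : ∀ i, 0 < p i) {ρ : ℝ} (hρ : ∀ i, p i ≤ ρ)
    (l : List (Fin m)) : wordProd p l ≤ ρ ^ l.length := by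
  induction l with
  | nil => simp [wordProd]
  | cons j l ih =>
    have h : wordProd p (j :: l) = p j * wordProd p l := by simp [wordProd]
    rw [h, List.length_cons, pow_succ']
    exact mul_le_mul (hρ j) ih (wordProd_pos hp l).le ((hp j).le.trans (hρ j))

theorem IsSimilarityRatio.wordMap {X : Type*} [MetricSpace X] {m : ℕ} {f : Fin m → X → X}
    {r : Fin m → ℝ} (hf : ∀ i, IsSimilarityRatio (f i) (r i)) (l : List (Fin m)) :
    IsSimilarityRatio (wordMap f l) (wordProd r l) := by
  induction l with
  | nil => intro x y; simp [_root_.wordMap, wordProd]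
  | cons j l ih =>
    have h : wordProd r (j :: l) = r j * wordProd r l := by simp [wordProd]
    rw [h]
    exact (hf j).comp ih

theorem wordMap_image_subset {X : Type*} {m : ℕ} {f : Fin m → X → X} {S : Set X}
    (hS : ∀ i, f i '' S ⊆ S) (l : List (Fin m)) : wordMap f l '' S ⊆ S := by
  induction l with
  | nil => simp [wordMap]
  | cons j l ih =>
    rw [wordMap, Set.image_comp]
    exact (Set.image_mono ih).trans (hS j)

theorem exists_length_eq_mem_wordMap_image {X : Type*} {m : ℕ} {f : Fin m → X → X} {E : Set X}
    (hE : E ⊆ ⋃ i, f i '' E) (k : ℕ) : ∀ x ∈ E, ∃ l : List (Fin m), l.length = k ∧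
      x ∈ wordMap f l '' E := by
  induction k with
  | zero => exact fun x hx => ⟨[], rfl, x, hx, rfl⟩
  | succ k ih =>
    intro x hx
    obtain ⟨i, e, he, rfl⟩ := Set.mem_iUnion.1 (hE hx)
    obtain ⟨l, hl, u, hu, rfl⟩ := ih e he
    exact ⟨i :: l, by simp [hl], u, hu, rfl⟩

theorem exists_wordProd_lt {m : ℕ} {r : Fin m → ℝ} (hr : ∀ i, r i ∈ Set.Ioo (0 : ℝ) 1) {ε : ℝ}
    (hε : 0 < ε) : ∃ K : ℕ, ∀ l : List (Fin m), K ≤ l.length → wordProd r l < ε := by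
  obtain ⟨ρ, hρ0, hρ1, hρ⟩ : ∃ ρ : ℝ, 0 ≤ ρ ∧ ρ < 1 ∧ ∀ i, r i ≤ ρ := by
    rcases isEmpty_or_nonempty (Fin m) with h | h
    · exact ⟨0, le_rfl, one_pos, fun i => h.elim i⟩
    · obtain ⟨i, hi⟩ := Finite.exists_max r
      exact ⟨r i, (hr i).1.le, (hr i).2, hi⟩
  obtain ⟨K, hK⟩ := exists_pow_lt_of_lt_one hε hρ1
  exact ⟨K, fun l hl => (wordProd_le_pow (fun i => (hr i).1) hρ l).trans_lt
    ((pow_le_pow_of_le_one hρ0 hρ1.le hl).trans_lt hK)⟩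

/-- Every point of a bounded self-similar set has arbitrarily small cylinders containing it. -/
theorem exists_wordMap_image_subset_ball {X : Type*} [MetricSpace X] {m : ℕ} {f : Fin m → X → X}
    {r : Fin m → ℝ} (hr : ∀ i, r i ∈ Set.Ioo (0 : ℝ) 1) (hf : ∀ i, IsSimilarityRatio (f i) (r i))
    {E : Set X} (hEb : Bornology.IsBounded E) (hE : E ⊆ ⋃ i, f i '' E) {x : X} (hx : x ∈ E)
    {ε : ℝ} (hε : 0 < ε) : ∃ l : List (Fin m), wordMap f l '' E ⊆ Metric.ball x ε := by
  obtain ⟨C, hC⟩ := Metric.isBounded_iff.1 hEb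
  have hC' : 0 < |C| + 1 := by positivity
  obtain ⟨K, hK⟩ := exists_wordProd_lt hr (div_pos hε hC')
  obtain ⟨l, hl, e, he, rfl⟩ := exists_length_eq_mem_wordMap_image hE K x hx
  refine ⟨l, ?_⟩
  rintro _ ⟨u, hu, rfl⟩
  rw [Metric.mem_ball, IsSimilarityRatio.wordMap hf l]
  calc wordProd r l * dist u e ≤ wordProd r l * (|C| + 1) :=
        mul_le_mul_of_nonneg_left (by linarith [hC hu he, le_abs_self C])
          (wordProd_pos (fun i => (hr i).1) l).le
    _ < ε := (lt_div_iff₀ hC').1 (hK l hl.ge)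

/-- A self-similar measure scales exactly along words on subsets of the feasible open set. -/
theorem measure_wordMap_image {X : Type*} [MetricSpace X] [CompleteSpace X] [MeasurableSpace X]
    [BorelSpace X] {m : ℕ} {f : Fin m → X → X} {r : Fin m → ℝ} (hr : ∀ i, 0 < r i)
    (hf : ∀ i, IsSimilarityRatio (f i) (r i)) {O : Set X} (hOmap : ∀ i, f i '' O ⊆ O)
    (hOdisj : ∀ i j, i ≠ j → Disjoint (f i '' O) (f j '' O))
    {p : Fin m → ℝ} (hp : ∀ i, 0 < p i) {μ : Measure X}
    (hinv : μ = ∑ i, ENNReal.ofReal (p i) • μ.map (f i)) (hO : μ Oᶜ = 0)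
    (l : List (Fin m)) {B : Set X} (hBO : B ⊆ O) :
    μ (wordMap f l '' B) = ENNReal.ofReal (wordProd p l) * μ B := by
  have hemb : ∀ i, MeasurableEmbedding (f i) := fun i => (hf i).measurableEmbedding (hr i)
  have hstep : ∀ j (B : Set X), B ⊆ O →
      μ (f j '' B) = ENNReal.ofReal (p j) * μ B := by
    intro j B hBO
    have h0 : μ (f j '' B) = ∑ i, ENNReal.ofReal (p i) * μ (f i ⁻¹' (f j '' B)) := by
      conv_lhs => rw [hinv]
      simp [Measure.finsetSum_apply, (hemb _).map_apply]
    rw [h0, Finset.sum_eq_single j, Set.preimage_image_eq _ (hemb j).injective]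
    · intro i _ hij
      have : f i ⁻¹' (f j '' B) ⊆ Oᶜ := fun u hu huO =>
        Set.disjoint_left.1 (hOdisj i j hij) ⟨u, huO, rfl⟩ (Set.image_mono hBO hu)
      rw [measure_mono_null this hO, mul_zero]
    · simp
  induction l with
  | nil => simp [wordMap, wordProd]
  | cons j l ih =>
    have h : wordProd p (j :: l) = p j * wordProd p l := by simp [wordProd]
    rw [wordMap, Set.image_comp,
      hstep j _ ((Set.image_mono hBO).trans (wordMap_image_subset hOmap l)), ih, h,
      ENNReal.ofReal_mul (hp j).le, mul_assoc]

/-- If the sphere is null, the measure of the trace of a ball depends continuously on its centre. -/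
theorem tendsto_measure_closedBall_inter {X : Type*} [MetricSpace X] [MeasurableSpace X]
    [BorelSpace X] {μ : Measure X} [IsFiniteMeasure μ] {x : X} {d : ℝ}
    (hsph : μ (Metric.sphere x d) = 0) {w : ℕ → X} (hw : Tendsto w atTop (𝓝 x)) {A : Set X}
    (hA : MeasurableSet A) :
    Tendsto (fun j => μ (Metric.closedBall (w j) d ∩ A)) atTop
      (𝓝 (μ (Metric.closedBall x d ∩ A))) := by
  refine tendsto_measure_of_ae_tendsto_indicator (B := Set.univ) atTop
    (Metric.isClosed_closedBall.measurableSet.inter hA)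
    (fun j => Metric.isClosed_closedBall.measurableSet.inter hA) MeasurableSet.univ
    (measure_ne_top _ _) (Eventually.of_forall fun _ => Set.subset_univ _) ?_
  filter_upwards [measure_eq_zero_iff_ae_notMem.1 hsph] with u hu
  have hdist : Tendsto (fun j => dist u (w j)) atTop (𝓝 (dist u x)) := tendsto_const_nhds.dist hw
  rcases lt_or_gt_of_ne (show dist u x ≠ d from hu) with h | h
  · filter_upwards [hdist.eventually_lt_const h] with j hj
    simp [Metric.mem_closedBall, hj.le, h.le]
  · filter_upwards [hdist.eventually_const_lt h] with j hj
    simp [Metric.mem_closedBall, hj.not_ge, h.not_ge]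

/-- under the SOSC, if `B(x,d) ⊆ O` with `x ∈ E`, `d > 0`, and `y ∈ E` has
dense shift orbit, then there is a sequence of words `i_j` with `r_{i_j} → 0` such that
`p_{i_j}⁻¹ (f_{i_j}⁻¹)_♯(μ_p⌊_{B(y, d r_{i_j})})` converges setwise to `μ_p⌊_{B(x,d)}`. -/
theorem stmt6 {n m : ℕ} (hn : 1 ≤ n) (hm : 2 ≤ m)
    (f : Fin m → EuclideanSpace ℝ (Fin n) → EuclideanSpace ℝ (Fin n))
    (r : Fin m → ℝ) (hr : ∀ i, r i ∈ Set.Ioo (0 : ℝ) 1)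
    (hsim : ∀ i, IsSimilarityRatio (f i) (r i))
    (E : Set (EuclideanSpace ℝ (Fin n))) (hEcomp : IsCompact E) (hEne : E.Nonempty)
    (hEattr : E = ⋃ i, f i '' E)
    (O : Set (EuclideanSpace ℝ (Fin n))) (hOopen : IsOpen O) (hOne : O.Nonempty)
    (hOmap : ∀ i, f i '' O ⊆ O)
    (hOdisj : ∀ i j, i ≠ j → Disjoint (f i '' O) (f j '' O))
    (hOE : (O ∩ E).Nonempty)
    (p : Fin m → ℝ) (hp : ∀ i, 0 < p i) (hpsum : ∑ i, p i = 1)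
    (μ : Measure (EuclideanSpace ℝ (Fin n))) (hprob : IsProbabilityMeasure μ)
    (hsupp : μ Eᶜ = 0)
    (hinv : μ = ∑ i, ENNReal.ofReal (p i) • μ.map (f i))
    (hfront : μ (frontier O) = 0)
    (hsph : ∀ (z : EuclideanSpace ℝ (Fin n)) (ρ : ℝ), μ (Metric.sphere z ρ) = 0)
    (x : EuclideanSpace ℝ (Fin n)) (hx : x ∈ E) (d : ℝ) (hd : 0 < d)
    (hball : Metric.closedBall x d ⊆ O)
    (y : EuclideanSpace ℝ (Fin n)) (hy : y ∈ E)
    (hdense : E ⊆ closure {w | w ∈ E ∧ ∃ l : List (Fin m), l ≠ [] ∧ wordMap f l w = y}) :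
    ∃ i : ℕ → List (Fin m),
      Tendsto (fun j => wordProd r (i j)) atTop (nhds 0) ∧
      ∀ A : Set (EuclideanSpace ℝ (Fin n)), MeasurableSet A →
        Tendsto
          (fun j => (ENNReal.ofReal (wordProd p (i j)))⁻¹ *
            μ (Metric.closedBall y (d * wordProd r (i j)) ∩ wordMap f (i j) '' A))
          atTop (nhds (μ (Metric.closedBall x d ∩ A))) := by
  have hr0 : ∀ i, 0 < r i := fun i => (hr i).1
  have hEsub : E ⊆ ⋃ i, f i '' E := hEattr.subset
  have hEmap : ∀ i, f i '' E ⊆ E := fun i => by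
    conv_rhs => rw [hEattr]
    exact Set.subset_iUnion (fun i => f i '' E) i
  have hEO : E ⊆ closure O := by
    obtain ⟨z, hzO, hzE⟩ := hOE
    refine fun u hu => Metric.mem_closure_iff.2 fun ε hε => ?_
    obtain ⟨l, hl⟩ := exists_wordMap_image_subset_ball hr hsim hEcomp.isBounded hEsub hu hε
    exact ⟨wordMap f l z, wordMap_image_subset hOmap l ⟨z, hzO, rfl⟩,
      Metric.mem_ball'.1 (hl ⟨z, hzE, rfl⟩)⟩
  have hOnull : μ Oᶜ = 0 := by
    refine measure_mono_null (t := frontier O ∪ Eᶜ) (fun u hu => ?_)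
      (measure_union_null hfront hsupp)
    by_cases huE : u ∈ E
    · exact Or.inl ⟨hEO huE, by rwa [hOopen.interior_eq]⟩
    · exact Or.inr huE
  have hatoms : NullSingletonClass μ := ⟨fun z => by simpa using hsph z 0⟩
  have hEinf : E.Infinite := fun hfin => by
    have h1 : μ Set.univ = 0 := by
      rw [← Set.union_compl_self E]
      exact measure_union_null (hfin.measure_zero μ) hsupp
    simp at h1
  have hpick : ∀ ε : ℝ, 0 < ε → ∃ (l : List (Fin m)) (w : EuclideanSpace ℝ (Fin n)),
      wordProd r l < ε ∧ dist w x < ε ∧ wordMap f l w = y := by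
    intro ε hε
    obtain ⟨K, hK⟩ := exists_wordProd_lt hr hε
    set F : Set (EuclideanSpace ℝ (Fin n)) :=
      ⋃ l ∈ {l : List (Fin m) | l.length < K}, wordMap f l ⁻¹' {y}
    have hF : F.Finite := (List.finite_length_lt (Fin m) K).biUnion fun l _ =>
      (Set.finite_singleton y).preimage
        ((IsSimilarityRatio.wordMap hsim l).injective (wordProd_pos hr0 l)).injOn
    obtain ⟨l₀, hl₀⟩ := exists_wordMap_image_subset_ball hr hsim hEcomp.isBounded hEsub hx hε
    have hinf : (wordMap f l₀ '' E).Infinite := hEinf.image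
      ((IsSimilarityRatio.wordMap hsim l₀).injective (wordProd_pos hr0 l₀)).injOn
    obtain ⟨u, hu, huF⟩ := hinf.exists_notMem_finite hF
    obtain ⟨w, ⟨hwball, hwF⟩, -, l, -, hlw⟩ :=
      mem_closure_iff.1 (hdense (wordMap_image_subset hEmap l₀ hu)) (Metric.ball x ε ∩ Fᶜ)
        (Metric.isOpen_ball.inter hF.isClosed.isOpen_compl) ⟨hl₀ hu, huF⟩
    refine ⟨l, w, hK l ?_, hwball, hlw⟩
    by_contra! hlK
    exact hwF (Set.mem_biUnion (x := l) hlK hlw)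
  choose i w hi hw hiw using fun j : ℕ => hpick (1 / ((j : ℝ) + 1)) (by positivity)
  have hlim := tendsto_one_div_add_atTop_nhds_zero_nat (𝕜 := ℝ)
  have hwx : Tendsto w atTop (𝓝 x) := tendsto_iff_dist_tendsto_zero.2
    (squeeze_zero (fun _ => dist_nonneg) (fun j => (hw j).le) hlim)
  refine ⟨i, squeeze_zero (fun j => (wordProd_pos hr0 (i j)).le) (fun j => (hi j).le) hlim,
    fun A hA => ?_⟩
  obtain ⟨δ, hδ, hδO⟩ :=
    (isCompact_closedBall x d).exists_thickening_subset_open hOopen hball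
  refine (tendsto_measure_closedBall_inter (hsph x d) hwx hA).congr' ?_
  filter_upwards [hwx (Metric.ball_mem_nhds x hδ)] with j hj
  have hsub : Metric.closedBall (w j) d ⊆ O := by
    rw [thickening_closedBall hδ hd.le] at hδO
    refine fun u hu => hδO ?_
    have h1 : dist (w j) x < δ := hj
    have h2 : dist u (w j) ≤ d := hu
    rw [Metric.mem_ball]
    linarith [dist_triangle u (w j) x]
  have hpos := wordProd_pos hp (i j)
  rw [← hiw j, (IsSimilarityRatio.wordMap hsim (i j)).image_closedBall_inter
      (wordProd_pos hr0 (i j)),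
    measure_wordMap_image hr0 hsim hOmap hOdisj hp hinv hOnull (i j)
      (Set.inter_subset_left.trans hsub),
    ← mul_assoc, ENNReal.inv_mul_cancel (by simpa using hpos) ENNReal.ofReal_ne_top, one_mul]
end
end

section
/- Assume Ψ satisfies the SOSC with feasible open set O, let s be the similarity dimension, let μ be the natural measure, and assume μ(∂O) = 0 and that μ gives zero measure to every sphere in ℝⁿ (known properties under the SOSC). Let m = inf{θ_μ^s(x, d) : B(x, d) a typical ball} and M = sup{θ_μ^s(x, d) : B(x, d) a typical ball}. Then the following chain of inclusions holds: (m, M) ⊆ {θ_μ^s(x, d) : B(x, d) a typical ball} ⊆ Spec(μ, O ∩ E) ⊆ [m, M]. -/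
open MeasureTheory Filter Topology
open scoped ENNReal

noncomputable section

/-- The `s`-density `θ_μ^s(x, d) = μ(B(x,d)) / (2d)^s` of the closed ball `B(x, d)`. -/
def sdens {n : ℕ} (μ : Measure (EuclideanSpace ℝ (Fin n))) (s : ℝ)
    (x : EuclideanSpace ℝ (Fin n)) (d : ℝ) : ℝ≥0∞ :=
  μ (Metric.closedBall x d) / ENNReal.ofReal ((2 * d) ^ s)

/-- The asymptotic spectrum `Spec(μ, x)`. -/
def specAt {n : ℕ} (μ : Measure (EuclideanSpace ℝ (Fin n))) (s : ℝ)
    (x : EuclideanSpace ℝ (Fin n)) : Set ℝ≥0∞ :=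
  {L | ∃ d : ℕ → ℝ, (∀ k, 0 < d k) ∧ Tendsto d atTop (nhds 0) ∧
    Tendsto (fun k => sdens μ s x (d k)) atTop (nhds L)}

/-- The set of `s`-densities of typical balls: `Im(θ_μ^s, 𝓑)`. -/
def typDens {n : ℕ} (μ : Measure (EuclideanSpace ℝ (Fin n))) (s : ℝ)
    (E O : Set (EuclideanSpace ℝ (Fin n))) : Set ℝ≥0∞ :=
  {t | ∃ x ∈ E, ∃ d : ℝ, 0 < d ∧ Metric.closedBall x d ⊆ O ∧ t = sdens μ s x d}

section SelfSimilarMeasures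

open Metric

/-- A similarity of a Euclidean space with positive ratio is onto. -/
theorem IsSimilarityRatio.surjective {n : ℕ}
    {f : EuclideanSpace ℝ (Fin n) → EuclideanSpace ℝ (Fin n)} {r : ℝ}
    (hf : IsSimilarityRatio f r) (hr : 0 < r) : Function.Surjective f := by
  have hg : Isometry fun x => r⁻¹ • f x := by
    refine Isometry.of_dist_eq fun x y => ?_
    rw [dist_smul₀, hf x y, Real.norm_eq_abs, abs_of_pos (inv_pos.2 hr),
      inv_mul_cancel_left₀ hr.ne']
  intro y
  obtain ⟨x, hx⟩ :=
    (hg.affineIsometryOfStrictConvexSpace.toAffineIsometryEquiv rfl).surjective (r⁻¹ • y)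
  have hx' : r⁻¹ • f x = r⁻¹ • y := hx
  exact ⟨x, smul_right_injective _ (inv_ne_zero hr.ne') hx'⟩

theorem IsSimilarityRatio.continuous {X : Type*} [MetricSpace X] {f : X → X} {r : ℝ}
    (hf : IsSimilarityRatio f r) : Continuous f :=
  (LipschitzWith.of_dist_le' fun x y => (hf x y).le).continuous

theorem IsSimilarityRatio.preimage_closedBall {X : Type*} [MetricSpace X] {f : X → X} {r : ℝ}
    (hf : IsSimilarityRatio f r) (hr : 0 < r) (x : X) (d : ℝ) :
    f ⁻¹' closedBall (f x) (r * d) = closedBall x d := by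
  ext y
  simp only [Set.mem_preimage, mem_closedBall, hf y x]
  exact mul_le_mul_iff_right₀ hr

theorem IsSimilarityRatio.image_closedBall {n : ℕ}
    {f : EuclideanSpace ℝ (Fin n) → EuclideanSpace ℝ (Fin n)} {r : ℝ}
    (hf : IsSimilarityRatio f r) (hr : 0 < r) (x : EuclideanSpace ℝ (Fin n)) (d : ℝ) :
    f '' closedBall x d = closedBall (f x) (r * d) := by
  rw [← hf.preimage_closedBall hr, Set.image_preimage_eq _ (hf.surjective hr)]

/-- The attractor lies in the closure of every nonempty set that the maps leave invariant. -/
theorem attractor_subset_closure {X ι : Type*} [MetricSpace X] {f : ι → X → X} {r : ι → ℝ}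
    (hr : ∀ i, r i ∈ Set.Ioo (0 : ℝ) 1) (hsim : ∀ i, IsSimilarityRatio (f i) (r i))
    {E O : Set X} (hE : IsCompact E) (hEattr : E = ⋃ i, f i '' E)
    (hO : O.Nonempty) (hOmap : ∀ i, f i '' O ⊆ O) : E ⊆ closure O := by
  intro x hx
  obtain ⟨z, hz, hmax⟩ := hE.exists_isMaxOn ⟨x, hx⟩ (continuous_infDist_pt O).continuousOn
  obtain ⟨i, y, hy, rfl⟩ : ∃ i, ∃ y ∈ E, f i y = z := by
    rw [hEattr] at hz
    simpa using hz
  have hcontr : infDist (f i y) O ≤ r i * infDist y O := by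
    rw [← div_le_iff₀' (hr i).1]
    refine (le_infDist hO).2 fun o ho => ?_
    rw [div_le_iff₀' (hr i).1, ← hsim i y o]
    exact infDist_le_dist_of_mem (hOmap i ⟨o, ho, rfl⟩)
  have hyz : infDist y O ≤ infDist (f i y) O := hmax hy
  have hxz : infDist x O ≤ infDist (f i y) O := hmax hx
  have := hr i
  rw [mem_closure_iff_infDist_zero hO]
  nlinarith [this.1, this.2, infDist_nonneg (x := x) (s := O),
    infDist_nonneg (x := y) (s := O), infDist_nonneg (x := f i y) (s := O)]

/-- If spheres are null, the measure of a closed ball depends continuously on its centre and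
radius. -/
theorem continuous_measure_closedBall {X : Type*} [MetricSpace X] [MeasurableSpace X]
    [OpensMeasurableSpace X] {μ : Measure X} [IsFiniteMeasure μ]
    (hsph : ∀ (z : X) (ρ : ℝ), μ (sphere z ρ) = 0) :
    Continuous fun p : X × ℝ => μ (closedBall p.1 p.2) := by
  refine continuous_iff_continuousAt.2 fun p => ?_
  refine tendsto_measure_of_ae_tendsto_indicator_of_isFiniteMeasure (𝓝 p)
    isClosed_closedBall.measurableSet (fun q => isClosed_closedBall.measurableSet) ?_
  have hae : ∀ᵐ y ∂μ, y ∉ sphere p.1 p.2 := measure_eq_zero_iff_ae_notMem.1 (hsph p.1 p.2)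
  filter_upwards [hae] with y hy
  have hc : Continuous fun q : X × ℝ => dist y q.1 := by fun_prop
  rcases lt_or_gt_of_ne (show dist y p.1 ≠ p.2 from hy) with h | h
  · filter_upwards [hc.continuousAt.eventually_lt continuous_snd.continuousAt h] with q hq
    simp [hq.le, h.le]
  · filter_upwards [continuous_snd.continuousAt.eventually_lt hc.continuousAt h] with q hq
    simp [hq.not_ge, h.not_ge]

theorem continuousAt_sdens {n : ℕ} {μ : Measure (EuclideanSpace ℝ (Fin n))} [IsFiniteMeasure μ]
    (hsph : ∀ (z : EuclideanSpace ℝ (Fin n)) (ρ : ℝ), μ (sphere z ρ) = 0) (s : ℝ)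
    {p : EuclideanSpace ℝ (Fin n) × ℝ} (hp : 0 < p.2) :
    ContinuousAt (fun q : EuclideanSpace ℝ (Fin n) × ℝ => sdens μ s q.1 q.2) p := by
  have hpow : ContinuousAt
      (fun q : EuclideanSpace ℝ (Fin n) × ℝ => ENNReal.ofReal ((2 * q.2) ^ s)) p := by
    refine ENNReal.continuous_ofReal.continuousAt.comp ?_
    exact ContinuousAt.rpow_const (by fun_prop) (Or.inl (by positivity))
  refine ENNReal.Tendsto.div (continuous_measure_closedBall hsph).continuousAt (Or.inr ?_) hpow
    (Or.inr (measure_ne_top _ _))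
  exact (ENNReal.ofReal_pos.2 (by positivity)).ne'

/-- The similarities preserve the density of every ball inside the feasible open set. -/
theorem sdens_image_eq {n : ℕ} {ι : Type*} [Fintype ι]
    {f : ι → EuclideanSpace ℝ (Fin n) → EuclideanSpace ℝ (Fin n)} {r : ι → ℝ}
    (hr : ∀ i, 0 < r i) (hsim : ∀ i, IsSimilarityRatio (f i) (r i))
    {O : Set (EuclideanSpace ℝ (Fin n))}
    (hOdisj : ∀ i j, i ≠ j → Disjoint (f i '' O) (f j '' O)) {s : ℝ}
    {μ : Measure (EuclideanSpace ℝ (Fin n))}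
    (hinv : μ = ∑ i, ENNReal.ofReal ((r i) ^ s) • μ.map (f i)) (hO : μ Oᶜ = 0) (i : ι)
    {x : EuclideanSpace ℝ (Fin n)} {d : ℝ} (hd : 0 < d) (hball : closedBall x d ⊆ O) :
    sdens μ s (f i x) (r i * d) = sdens μ s x d := by
  have hother : ∀ j, j ≠ i → μ (f j ⁻¹' closedBall (f i x) (r i * d)) = 0 := by
    intro j hj
    refine measure_mono_null (t := Oᶜ) (fun y hy hyO => ?_) hO
    rw [Set.mem_preimage, ← (hsim i).image_closedBall (hr i)] at hy
    exact (hOdisj j i hj).le_bot ⟨⟨y, hyO, rfl⟩, Set.image_mono hball hy⟩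
  have hmeas : μ (closedBall (f i x) (r i * d))
      = ENNReal.ofReal ((r i) ^ s) * μ (closedBall x d) := by
    conv_lhs => rw [hinv]
    simp only [Measure.coe_finsetSum, Finset.sum_apply, Measure.smul_apply, smul_eq_mul]
    rw [Finset.sum_eq_single i]
    · rw [Measure.map_apply (hsim i).continuous.measurable isClosed_closedBall.measurableSet,
        (hsim i).preimage_closedBall (hr i)]
    · intro j _ hj
      rw [Measure.map_apply (hsim j).continuous.measurable isClosed_closedBall.measurableSet,
        hother j hj, mul_zero]
    · exact fun h => (h (Finset.mem_univ i)).elim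
  have hpow : ENNReal.ofReal ((2 * (r i * d)) ^ s)
      = ENNReal.ofReal ((r i) ^ s) * ENNReal.ofReal ((2 * d) ^ s) := by
    rw [← ENNReal.ofReal_mul (Real.rpow_nonneg (hr i).le s),
      ← Real.mul_rpow (hr i).le (by positivity)]
    ring_nf
  unfold sdens
  rw [hmeas, hpow, ENNReal.mul_div_mul_left _ _
    (ENNReal.ofReal_pos.2 (Real.rpow_pos_of_pos (hr i) s)).ne' ENNReal.ofReal_ne_top]

/-- Every typical ball has arbitrarily small typical copies with the same density near any given
point of the attractor. -/
theorem exists_typical_copy_near {n : ℕ} {ι : Type*} [Fintype ι]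
    {f : ι → EuclideanSpace ℝ (Fin n) → EuclideanSpace ℝ (Fin n)} {r : ι → ℝ}
    (hr : ∀ i, r i ∈ Set.Ioo (0 : ℝ) 1) (hsim : ∀ i, IsSimilarityRatio (f i) (r i))
    {E O : Set (EuclideanSpace ℝ (Fin n))} (hE : IsCompact E) (hEattr : E = ⋃ i, f i '' E)
    (hOmap : ∀ i, f i '' O ⊆ O) (hOdisj : ∀ i j, i ≠ j → Disjoint (f i '' O) (f j '' O)) {s : ℝ}
    {μ : Measure (EuclideanSpace ℝ (Fin n))}
    (hinv : μ = ∑ i, ENNReal.ofReal ((r i) ^ s) • μ.map (f i)) (hO : μ Oᶜ = 0)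
    {x y : EuclideanSpace ℝ (Fin n)} (hx : x ∈ E) (hy : y ∈ E) {d : ℝ} (hd : 0 < d)
    (hball : closedBall x d ⊆ O) {ε : ℝ} (hε : 0 < ε) :
    ∃ z ∈ E, ∃ δ ∈ Set.Ioo 0 ε, dist z y < ε ∧ closedBall z δ ⊆ O ∧
      sdens μ s z δ = sdens μ s x d := by
  have hcover : ∀ y ∈ E, ∃ i, ∃ y' ∈ E, f i y' = y := by
    intro y hy
    rw [hEattr] at hy
    simpa using hy
  have hmaps : ∀ i, ∀ y ∈ E, f i y ∈ E := by
    intro i y hy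
    rw [hEattr]
    exact Set.mem_iUnion.2 ⟨i, y, hy, rfl⟩
  have : Nonempty ι := (hcover y hy).nonempty
  obtain ⟨i₀, hi₀⟩ := Finite.exists_max r
  obtain ⟨D, hD⟩ := isBounded_iff.1 hE.isBounded
  have hD0 : 0 ≤ D := dist_self x ▸ hD hx hx
  have hcopy : ∀ k : ℕ, ∀ y ∈ E, ∃ z ∈ E, ∃ δ, 0 < δ ∧ δ ≤ r i₀ ^ k * d ∧
      dist z y ≤ r i₀ ^ k * D ∧ closedBall z δ ⊆ O ∧ sdens μ s z δ = sdens μ s x d := by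
    intro k
    induction k with
    | zero => exact fun y hy => ⟨x, hx, d, hd, by simp, by simpa using hD hx hy, hball, rfl⟩
    | succ k ih =>
      intro y hy
      obtain ⟨i, y', hy', rfl⟩ := hcover y hy
      obtain ⟨z, hz, δ, hδ, hδd, hzy, hzO, hdens⟩ := ih y' hy'
      refine ⟨f i z, hmaps i z hz, r i * δ, mul_pos (hr i).1 hδ, ?_, ?_, ?_, ?_⟩
      · rw [pow_succ', mul_assoc]
        exact mul_le_mul (hi₀ i) hδd hδ.le (hr i₀).1.le
      · rw [hsim i, pow_succ', mul_assoc]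
        exact mul_le_mul (hi₀ i) hzy dist_nonneg (hr i₀).1.le
      · rw [← (hsim i).image_closedBall (hr i).1]
        exact (Set.image_mono hzO).trans (hOmap i)
      · rw [sdens_image_eq (fun j => (hr j).1) hsim hOdisj hinv hO i hδ hzO, hdens]
  have hpow := tendsto_pow_atTop_nhds_zero_of_lt_one (hr i₀).1.le (hr i₀).2
  have hsmall : ∀ C : ℝ, ∀ᶠ k : ℕ in atTop, r i₀ ^ k * C < ε := fun C =>
    (hpow.mul_const C).eventually_lt_const (by simpa using hε)
  obtain ⟨k, hkd, hkD⟩ := ((hsmall d).and (hsmall D)).exists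
  obtain ⟨z, hz, δ, hδ, hδd, hzy, hzO, hdens⟩ := hcopy k y hy
  exact ⟨z, hz, δ, ⟨hδ, hδd.trans_lt hkd⟩, hzy.trans_lt hkD, hzO, hdens⟩

/-- A value attained by the density at arbitrarily small scales near every point of a compact set
`E` is in the asymptotic spectrum of some point in any open set that meets `E`. -/
theorem exists_mem_specAt {n : ℕ} {E O : Set (EuclideanSpace ℝ (Fin n))} (hE : IsCompact E)
    (hOopen : IsOpen O) (hOE : (O ∩ E).Nonempty) {s : ℝ}
    {μ : Measure (EuclideanSpace ℝ (Fin n))} [IsFiniteMeasure μ]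
    (hsph : ∀ (z : EuclideanSpace ℝ (Fin n)) (ρ : ℝ), μ (sphere z ρ) = 0) {t : ℝ≥0∞}
    (ht : ∀ y ∈ E, ∀ ε > 0, ∃ z ∈ E, ∃ δ ∈ Set.Ioo 0 ε, dist z y < ε ∧ sdens μ s z δ = t) :
    ∃ x ∈ O ∩ E, t ∈ specAt μ s x := by
  have : CompactSpace E := isCompact_iff_compactSpace.1 hE
  obtain ⟨V, hV⟩ := (𝓝 t).exists_antitone_basis
  let U : ℕ → Set E := fun k =>
    ⋃ δ ∈ Set.Ioo (0 : ℝ) (1 / (k + 1)), {z : E | sdens μ s z δ ∈ interior (V k)}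
  have hUopen : ∀ k, IsOpen (U k) := by
    refine fun k => isOpen_biUnion fun δ hδ => isOpen_interior.preimage ?_
    refine continuous_iff_continuousAt.2 fun z => ?_
    exact (continuousAt_sdens hsph s (p := ((z : EuclideanSpace ℝ (Fin n)), δ)) hδ.1).comp
      (f := fun z : E => ((z : EuclideanSpace ℝ (Fin n)), δ)) (by fun_prop)
  have hUdense : ∀ k, Dense (U k) := by
    intro k y
    rw [Metric.mem_closure_iff]
    intro ε hε
    obtain ⟨z, hz, δ, hδ, hzy, hdens⟩ :=
      ht y y.2 (min ε (1 / (k + 1))) (lt_min hε (by positivity))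
    refine ⟨⟨z, hz⟩, Set.mem_biUnion ⟨hδ.1, hδ.2.trans_le (min_le_right _ _)⟩ ?_, ?_⟩
    · change sdens μ s z δ ∈ interior (V k)
      rw [hdens]
      exact mem_interior_iff_mem_nhds.2 (hV.1.mem_of_mem trivial)
    · rw [dist_comm]
      exact hzy.trans_le (min_le_left _ _)
  obtain ⟨y, hyO, hyE⟩ := hOE
  obtain ⟨z, hzO, hzU⟩ := (dense_iInter_of_isOpen_nat hUopen hUdense).inter_open_nonempty
    (Subtype.val ⁻¹' O) (hOopen.preimage continuous_subtype_val) ⟨⟨y, hyE⟩, hyO⟩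
  have hex : ∀ k : ℕ, ∃ δ ∈ Set.Ioo (0 : ℝ) (1 / (k + 1)), sdens μ s z δ ∈ V k := by
    intro k
    obtain ⟨δ, hδ, hmem⟩ := Set.mem_iUnion₂.1 (Set.mem_iInter.1 hzU k)
    exact ⟨δ, hδ, interior_subset hmem⟩
  choose δ hδ hδV using hex
  exact ⟨z, ⟨hzO, z.2⟩, δ, fun k => (hδ k).1,
    squeeze_zero (fun k => (hδ k).1.le) (fun k => (hδ k).2.le)
      tendsto_one_div_add_atTop_nhds_zero_nat, hV.tendsto hδV⟩

/-- At a point with two balls inside `O`, all densities between theirs are typical. -/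
theorem uIcc_sdens_subset_typDens {n : ℕ} {E O : Set (EuclideanSpace ℝ (Fin n))} {s : ℝ}
    {μ : Measure (EuclideanSpace ℝ (Fin n))} [IsFiniteMeasure μ]
    (hsph : ∀ (z : EuclideanSpace ℝ (Fin n)) (ρ : ℝ), μ (sphere z ρ) = 0)
    {x : EuclideanSpace ℝ (Fin n)} (hx : x ∈ E) {a b : ℝ} (ha : 0 < a) (hb : 0 < b)
    (haO : closedBall x a ⊆ O) (hbO : closedBall x b ⊆ O) :
    Set.uIcc (sdens μ s x a) (sdens μ s x b) ⊆ typDens μ s E O := by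
  have hpos : ∀ d ∈ Set.uIcc a b, 0 < d := fun d hd => (lt_min ha hb).trans_le hd.1
  have hcont : ContinuousOn (fun d => sdens μ s x d) (Set.uIcc a b) := fun d hd =>
    ((continuousAt_sdens hsph s (p := (x, d)) (hpos d hd)).comp
      (f := fun d : ℝ => (x, d)) (by fun_prop)).continuousWithinAt
  rintro t ht
  obtain ⟨d, hd, rfl⟩ := intermediate_value_uIcc hcont ht
  refine ⟨x, hx, d, hpos d hd, ?_, rfl⟩
  rcases le_max_iff.1 hd.2 with h | h
  · exact (closedBall_subset_closedBall h).trans haO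
  · exact (closedBall_subset_closedBall h).trans hbO

/-- Points near the centre of a ball inside an open set have a ball of the same radius inside it. -/
theorem eventually_closedBall_same_radius_subset {V : Type*} [NormedAddCommGroup V]
    [NormedSpace ℝ V] [ProperSpace V] {O : Set V} (hO : IsOpen O) {x : V} {d : ℝ} (hd : 0 ≤ d)
    (hball : closedBall x d ⊆ O) : ∀ᶠ y in 𝓝 x, closedBall y d ⊆ O := by
  obtain ⟨ε, hε, hεO⟩ := (isCompact_closedBall x d).exists_cthickening_subset_open hO hball
  rw [cthickening_closedBall hε.le hd] at hεO
  filter_upwards [ball_mem_nhds x hε] with y hy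
  refine (closedBall_subset_closedBall' ?_).trans hεO
  linarith [mem_ball.1 hy]

end SelfSimilarMeasures

/-- with `m = inf` and `M = sup` of the densities of typical balls,
`(m, M) ⊆ Im(θ_μ^s, 𝓑) ⊆ Spec(μ, O ∩ E) ⊆ [m, M]`. -/
theorem stmt11 {n m : ℕ} (hn : 1 ≤ n) (hm : 2 ≤ m)
    (f : Fin m → EuclideanSpace ℝ (Fin n) → EuclideanSpace ℝ (Fin n))
    (r : Fin m → ℝ) (hr : ∀ i, r i ∈ Set.Ioo (0 : ℝ) 1)
    (hsim : ∀ i, IsSimilarityRatio (f i) (r i))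
    (E : Set (EuclideanSpace ℝ (Fin n))) (hEcomp : IsCompact E) (hEne : E.Nonempty)
    (hEattr : E = ⋃ i, f i '' E)
    (O : Set (EuclideanSpace ℝ (Fin n))) (hOopen : IsOpen O) (hOne : O.Nonempty)
    (hOmap : ∀ i, f i '' O ⊆ O)
    (hOdisj : ∀ i j, i ≠ j → Disjoint (f i '' O) (f j '' O))
    (hOE : (O ∩ E).Nonempty)
    (s : ℝ) (hs : ∑ i, (r i) ^ s = 1)
    (μ : Measure (EuclideanSpace ℝ (Fin n))) (hprob : IsProbabilityMeasure μ)
    (hsupp : μ Eᶜ = 0)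
    (hinv : μ = ∑ i, ENNReal.ofReal ((r i) ^ s) • μ.map (f i))
    (hfront : μ (frontier O) = 0)
    (hsph : ∀ (z : EuclideanSpace ℝ (Fin n)) (ρ : ℝ), μ (Metric.sphere z ρ) = 0) :
    Set.Ioo (sInf (typDens μ s E O)) (sSup (typDens μ s E O)) ⊆ typDens μ s E O ∧
    typDens μ s E O ⊆ ⋃ x ∈ O ∩ E, specAt μ s x ∧
    (⋃ x ∈ O ∩ E, specAt μ s x) ⊆
      Set.Icc (sInf (typDens μ s E O)) (sSup (typDens μ s E O)) := by
  have hO : μ Oᶜ = 0 := by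
    have hsub : Oᶜ ⊆ Eᶜ ∪ frontier O := by
      intro x hx
      by_cases hxE : x ∈ E
      · refine Or.inr ⟨attractor_subset_closure hr hsim hEcomp hEattr hOne hOmap hxE, ?_⟩
        rwa [hOopen.interior_eq]
      · exact Or.inl hxE
    exact measure_mono_null hsub (measure_union_null hsupp hfront)
  refine ⟨?_, ?_, ?_⟩
  · rintro t ⟨htm, htM⟩
    obtain ⟨_, ⟨x, hx, a, ha, haO, rfl⟩, hxt⟩ := sInf_lt_iff.1 htm
    obtain ⟨_, ⟨y, hy, b, hb, hbO, rfl⟩, hyt⟩ := lt_sSup_iff.1 htM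
    have hnear : ∀ᶠ z in 𝓝 x, sdens μ s z a < t :=
      ((continuousAt_sdens hsph s (p := (x, a)) ha).comp
        (f := fun z => (z, a)) (by fun_prop)).eventually_lt_const hxt
    obtain ⟨ε, hε, hεx⟩ :=
      Metric.eventually_nhds_iff.1 (hnear.and (eventually_closedBall_same_radius_subset hOopen ha.le haO))
    obtain ⟨z, hz, δ, hδ, hzx, hzO, hdens⟩ := exists_typical_copy_near hr hsim hEcomp hEattr hOmap
      hOdisj hinv hO hy hx hb hbO hε
    exact uIcc_sdens_subset_typDens hsph hz ha hδ.1 (hεx hzx).2 hzO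
      (Set.Icc_subset_uIcc ⟨(hεx hzx).1.le, by rw [hdens]; exact hyt.le⟩)
  · rintro _ ⟨x, hx, d, hd, hdO, rfl⟩
    obtain ⟨z, hz, hspec⟩ := exists_mem_specAt (s := s) (t := sdens μ s x d) hEcomp hOopen hOE hsph
      fun y hy ε hε => by
        obtain ⟨z, hz, δ, hδ, hzy, -, hdens⟩ := exists_typical_copy_near hr hsim hEcomp hEattr
          hOmap hOdisj hinv hO hx hy hd hdO hε
        exact ⟨z, hz, δ, hδ, hzy, hdens⟩
    exact Set.mem_biUnion hz hspec
  · refine Set.iUnion₂_subset fun x hx => ?_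
    rintro L ⟨d, hd, hd0, hL⟩
    obtain ⟨ε, hε, hεO⟩ := Metric.nhds_basis_closedBall.mem_iff.1 (hOopen.mem_nhds hx.1)
    refine isClosed_Icc.mem_of_tendsto hL ?_
    filter_upwards [hd0.eventually_le_const hε] with k hk
    have hmem : sdens μ s x (d k) ∈ typDens μ s E O :=
      ⟨x, hx.2, d k, hd k, (Metric.closedBall_subset_closedBall hk).trans hεO, rfl⟩
    exact ⟨sInf_le hmem, le_sSup hmem⟩
end
end
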